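/- For every finite connected simple graph G, the rainbow connection number of G is at most |V(G)| − fvs(G) + 2, where fvs(G) is the feedback vertex set number of G. -/

import Mathlib

open SimpleGraph

/-- A coloring `c` of the (potential) edges of `G` makes `G` rainbow-connected if every pair of
vertices is joined by a path whose edges all receive pairwise distinct colors. -/
def IsRainbowConnected {V : Type*} {n : ℕ} (G : SimpleGraph V) (c : Sym2 V → Fin n) : Prop :=
  ∀ u v : V, ∃ p : G.Walk u v, p.IsPath ∧ (p.edges.map c).Nodup

/- The feedback vertex set number of `G`: the minimum number of vertices whose removal
leaves an induced acyclic subgraph. -/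
noncomputable def fvsNum {V : Type*} [Fintype V] (G : SimpleGraph V) : ℕ :=
  sInf {n : ℕ | ∃ W : Finset V, W.card = n ∧ (G.induce ((↑W : Set V)ᶜ)).IsAcyclic}

/-- The subgraph of `G` induced on `S`, as a graph on the original vertex type. -/
def restr {V : Type*} (G : SimpleGraph V) (S : Finset V) : SimpleGraph V where
  Adj u v := G.Adj u v ∧ u ∈ S ∧ v ∈ S
  symm := ⟨fun _ _ h => ⟨h.1.symm, h.2.2, h.2.1⟩⟩
  loopless := ⟨fun _ h => h.1.ne rfl⟩

section Acyclic

variable {V : Type*} {G : SimpleGraph V}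

lemma restr_mono {S T : Finset V} (h : S ⊆ T) : restr G S ≤ restr G T :=
  fun _ _ hu => ⟨hu.1, h hu.2.1, h hu.2.2⟩

lemma restr_singleton_isAcyclic (r : V) : (restr G {r}).IsAcyclic := by
  have : restr G {r} = ⊥ := by
    ext u v
    simp only [restr, Finset.mem_singleton, bot_adj, iff_false]
    rintro ⟨h, rfl, rfl⟩
    exact h.ne rfl
  rw [this]
  exact isAcyclic_bot

lemma edges_mem_of_closed {H H' : SimpleGraph V} {A : Set V}
    (hA : ∀ u v, u ∈ A → H.Adj u v → v ∈ A ∧ H'.Adj u v) {u v : V} (p : H.Walk u v)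
    (hu : u ∈ A) : v ∈ A ∧ ∀ e ∈ p.edges, e ∈ H'.edgeSet := by
  induction p with
  | nil => exact ⟨hu, by simp⟩
  | cons h p ih =>
    obtain ⟨h1, h2⟩ := hA _ _ hu h
    obtain ⟨h3, h4⟩ := ih h1
    refine ⟨h3, fun e he => ?_⟩
    rw [Walk.edges_cons, List.mem_cons] at he
    rcases he with rfl | he
    · exact h2
    · exact h4 e he

variable [DecidableEq V]

/-- Two disjoint induced forests joined by at most one edge form an induced forest. -/
lemma isAcyclic_restr_union {A B : Finset V} (hAB : Disjoint A B)
    (hA : (restr G A).IsAcyclic) (hB : (restr G B).IsAcyclic) (a b : V)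
    (h : ∀ u ∈ A, ∀ v ∈ B, G.Adj u v → u = a ∧ v = b) : (restr G (A ∪ B)).IsAcyclic := by
  have hd : ∀ x, x ∈ A → x ∉ B := fun x hx hx' => Finset.disjoint_left.1 hAB hx hx'
  have clA : ∀ u v, u ∈ (A : Set V) → (restr G A ⊔ restr G B).Adj u v →
      v ∈ (A : Set V) ∧ (restr G A).Adj u v := by
    intro u v hu huv
    rcases huv with huv | huv
    · exact ⟨huv.2.2, huv⟩
    · exact absurd huv.2.1 (hd u hu)
  have clB : ∀ u v, u ∈ (B : Set V) → (restr G A ⊔ restr G B).Adj u v →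
      v ∈ (B : Set V) ∧ (restr G B).Adj u v := by
    intro u v hu huv
    rcases huv with huv | huv
    · exact absurd hu (hd u huv.2.1)
    · exact ⟨huv.2.2, huv⟩
  have hsup : (restr G A ⊔ restr G B).IsAcyclic := by
    intro u p hp
    have hadj := p.adj_snd hp.not_nil
    rcases hadj with hadj | hadj
    · exact hA _ (hp.transfer (edges_mem_of_closed clA p hadj.2.1).2)
    · exact hB _ (hp.transfer (edges_mem_of_closed clB p hadj.2.1).2)
  by_cases hab : a ∈ A ∧ b ∈ B
  · have hnr : ¬ (restr G A ⊔ restr G B).Reachable a b := by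
      rintro ⟨p⟩
      exact hd b (edges_mem_of_closed clA p hab.1).1 hab.2
    refine (IsAcyclic.sup_edge_of_not_reachable hnr hsup).anti ?_
    rintro u v ⟨huv, hu, hv⟩
    rw [sup_adj, sup_adj, edge_adj]
    rw [Finset.mem_union] at hu hv
    rcases hu with hu | hu <;> rcases hv with hv | hv
    · exact Or.inl (Or.inl ⟨huv, hu, hv⟩)
    · exact Or.inr ⟨Or.inl (h u hu v hv huv), huv.ne⟩
    · obtain ⟨h1, h2⟩ := h v hv u hu huv.symm
      exact Or.inr ⟨Or.inr ⟨h2, h1⟩, huv.ne⟩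
    · exact Or.inl (Or.inr ⟨huv, hu, hv⟩)
  · refine hsup.anti ?_
    rintro u v ⟨huv, hu, hv⟩
    rw [sup_adj]
    rw [Finset.mem_union] at hu hv
    rcases hu with hu | hu <;> rcases hv with hv | hv
    · exact Or.inl ⟨huv, hu, hv⟩
    · obtain ⟨rfl, rfl⟩ := h u hu v hv huv
      exact absurd ⟨hu, hv⟩ hab
    · obtain ⟨rfl, rfl⟩ := h v hv u hu huv.symm
      exact absurd ⟨hv, hu⟩ hab
    · exact Or.inr ⟨huv, hu, hv⟩

/-- Pairwise non-adjacent induced forests, each joined to a central induced forest by at most one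
edge, form an induced forest. -/
lemma isAcyclic_restr_union_biUnion {A : Finset V} (X : Finset V) (B : V → Finset V)
    (hA : (restr G A).IsAcyclic) (hB : ∀ i ∈ X, (restr G (B i)).IsAcyclic)
    (hAB : ∀ i ∈ X, Disjoint A (B i)) (hBB : ∀ i ∈ X, ∀ j ∈ X, i ≠ j → Disjoint (B i) (B j))
    (a b : V → V) (h : ∀ i ∈ X, ∀ u ∈ A, ∀ v ∈ B i, G.Adj u v → u = a i ∧ v = b i)
    (hij : ∀ i ∈ X, ∀ j ∈ X, i ≠ j → ∀ u ∈ B i, ∀ v ∈ B j, ¬ G.Adj u v) :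
    (restr G (A ∪ X.biUnion B)).IsAcyclic := by
  induction X using Finset.induction_on with
  | empty => simpa using hA
  | insert x X hx ih =>
    have hne : ∀ i ∈ X, i ≠ x := fun i hi hix => hx (hix ▸ hi)
    have ih' := ih (fun i hi => hB i (Finset.mem_insert_of_mem hi))
      (fun i hi => hAB i (Finset.mem_insert_of_mem hi))
      (fun i hi j hj => hBB i (Finset.mem_insert_of_mem hi) j (Finset.mem_insert_of_mem hj))
      (fun i hi => h i (Finset.mem_insert_of_mem hi))
      (fun i hi j hj => hij i (Finset.mem_insert_of_mem hi) j (Finset.mem_insert_of_mem hj))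
    have heq : A ∪ (insert x X).biUnion B = (A ∪ X.biUnion B) ∪ B x := by
      rw [Finset.biUnion_insert, Finset.union_comm (B x), Finset.union_assoc]
    rw [heq]
    refine isAcyclic_restr_union ?_ ih' (hB x (Finset.mem_insert_self _ _)) (a x) (b x) ?_
    · rw [Finset.disjoint_union_left, Finset.disjoint_biUnion_left]
      exact ⟨hAB x (Finset.mem_insert_self _ _), fun i hi =>
        hBB i (Finset.mem_insert_of_mem hi) x (Finset.mem_insert_self _ _) (hne i hi)⟩
    · intro u hu v hv huv
      rw [Finset.mem_union, Finset.mem_biUnion] at hu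
      rcases hu with hu | ⟨i, hi, hu⟩
      · exact h x (Finset.mem_insert_self _ _) u hu v hv huv
      · exact absurd huv (hij i (Finset.mem_insert_of_mem hi) x (Finset.mem_insert_self _ _)
          (hne i hi) u hu v hv)

end Acyclic

/-- `RainbowReach G c S A u v`: some walk from `u` to `v` inside `S` has pairwise distinct edge
colors, all of them in `A`. -/
inductive RainbowReach {V C : Type*} (G : SimpleGraph V) (c : Sym2 V → C) (S : Finset V) :
    Set C → V → V → Prop
  | nil (A : Set C) (u : V) : RainbowReach G c S A u u
  | cons {A : Set C} {u v w : V} (h : G.Adj u v) (hu : u ∈ S) (hv : v ∈ S) (hc : c s(u, v) ∈ A)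
      (hp : RainbowReach G c S (A \ {c s(u, v)}) v w) : RainbowReach G c S A u w

namespace RainbowReach

variable {V C : Type*} {G : SimpleGraph V} {c c' : Sym2 V → C} {S S' : Finset V}
  {A B : Set C} {u v w : V}

lemma mono (h : RainbowReach G c S A u v) (hS : S ⊆ S') (hAB : A ⊆ B) :
    RainbowReach G c S' B u v := by
  induction h generalizing B with
  | nil => exact nil _ _
  | cons h hu hv hc _ ih =>
    exact cons h (hS hu) (hS hv) (hAB hc) (ih (Set.sdiff_subset_sdiff_left hAB))

lemma congr (h : RainbowReach G c S A u v)
    (hcc : ∀ x ∈ S, ∀ y ∈ S, c' s(x, y) = c s(x, y)) : RainbowReach G c' S A u v := by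
  induction h with
  | nil => exact nil _ _
  | cons h hu hv hc _ ih =>
    have he := hcc _ hu _ hv
    exact cons h hu hv (he ▸ hc) (he ▸ ih)

lemma trans (h : RainbowReach G c S A u v) (h' : RainbowReach G c S B v w)
    (hAB : Disjoint A B) : RainbowReach G c S (A ∪ B) u w := by
  induction h with
  | nil => exact h'.mono (Finset.Subset.refl _) Set.subset_union_right
  | @cons A u v x h hu hv hc _ ih =>
    refine cons h hu hv (Or.inl hc) ?_
    refine (ih h' (hAB.mono_left Set.sdiff_subset)).mono (Finset.Subset.refl _) ?_
    rintro k (hk | hk)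
    · exact ⟨Or.inl hk.1, hk.2⟩
    · refine ⟨Or.inr hk, ?_⟩
      rintro rfl
      exact Set.disjoint_left.1 hAB hc hk

lemma trans' {D : Set C} (h : RainbowReach G c S A u v) (h' : RainbowReach G c S B v w)
    (hAB : Disjoint A B) (hA : A ⊆ D) (hB : B ⊆ D) : RainbowReach G c S D u w :=
  (h.trans h' hAB).mono (Finset.Subset.refl _) (Set.union_subset hA hB)

lemma single (h : G.Adj u v) (hu : u ∈ S) (hv : v ∈ S) {k : C} (hc : c s(u, v) = k) :
    RainbowReach G c S {k} u v :=
  cons h hu hv hc (nil _ _)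

lemma symm (h : RainbowReach G c S A u v) : RainbowReach G c S A v u := by
  induction h with
  | nil => exact nil _ _
  | @cons A u v x h hu hv hc _ ih =>
    refine ih.trans' (single h.symm hv hu (by rw [Sym2.eq_swap])) ?_ Set.sdiff_subset
      (Set.singleton_subset_iff.2 hc)
    exact Set.disjoint_sdiff_left

lemma exists_walk (h : RainbowReach G c S A u v) :
    ∃ p : G.Walk u v, (p.edges.map c).Nodup ∧ ∀ e ∈ p.edges, c e ∈ A := by
  induction h with
  | nil => exact ⟨Walk.nil, by simp, by simp⟩
  | cons h hu hv hc _ ih =>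
    obtain ⟨p, hp, hpA⟩ := ih
    refine ⟨Walk.cons h p, ?_, ?_⟩
    · rw [Walk.edges_cons, List.map_cons, List.nodup_cons]
      refine ⟨fun hm => ?_, hp⟩
      obtain ⟨e, he, hce⟩ := List.mem_map.1 hm
      exact (hpA e he).2 hce
    · intro e he
      rw [Walk.edges_cons, List.mem_cons] at he
      rcases he with rfl | he
      · exact hc
      · exact (hpA e he).1

lemma exists_path (h : RainbowReach G c S A u v) :
    ∃ p : G.Walk u v, p.IsPath ∧ (p.edges.map c).Nodup ∧ ∀ e ∈ p.edges, c e ∈ A := by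
  classical
  obtain ⟨p, hp, hA⟩ := h.exists_walk
  exact ⟨p.bypass, p.bypass_isPath, hp.sublist (p.edges_bypass_sublist_edges.map c),
    fun e he => hA e (p.edges_bypass_subset_edges he)⟩

end RainbowReach

section Tree

variable {V : Type*} [DecidableEq V] {G : SimpleGraph V}

/-- An induced tree on `T` with root `r`, where `D b u` says that `u` lies in the subtree below
`b`, and `c` is a rainbow coloring with one color for each vertex other than the root: walks that
start and end outside the subtree below `b` can avoid the color `b`. -/
structure IsColoredTree (G : SimpleGraph V) (r : V) (T : Finset V) (c : Sym2 V → Fin 3 ⊕ V)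
    (D : V → V → Prop) : Prop where
  root_mem : r ∈ T
  acyclic : (restr G T).IsAcyclic
  antisymm : ∀ b ∈ T, ∀ b' ∈ T, D b b' → D b' b → b = b'
  root_below : ∀ u ∈ T, D r u
  reach : ∀ u ∈ T, ∀ v ∈ T, RainbowReach G c T (Sum.inr '' (↑(T.erase r) : Set V)) u v
  reach_avoid : ∀ b ∈ T, ∀ u ∈ T, ∀ v ∈ T, ¬ D b u → ¬ D b v →
    RainbowReach G c T (Sum.inr '' (↑((T.erase r).erase b) : Set V)) u v

lemma isColoredTree_singleton (r : V) :
    IsColoredTree G r {r} (fun _ => Sum.inl 0) (fun _ _ => True) where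
  root_mem := Finset.mem_singleton_self r
  acyclic := restr_singleton_isAcyclic r
  antisymm b hb b' hb' _ _ := by
    rw [Finset.mem_singleton] at hb hb'
    rw [hb, hb']
  root_below _ _ := trivial
  reach u hu v hv := by
    rw [Finset.mem_singleton] at hu hv
    rw [hu, hv]
    exact .nil _ _
  reach_avoid _ _ u _ _ _ h := absurd trivial h

lemma IsColoredTree.insert {r : V} {T : Finset V} {c : Sym2 V → Fin 3 ⊕ V} {D : V → V → Prop}
    (h : IsColoredTree G r T c D) {z w : V} (hz : z ∉ T) (hw : w ∈ T) (hzw : G.Adj z w)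
    (huniq : ∀ t ∈ T, G.Adj z t → t = w) :
    IsColoredTree G r (insert z T) (fun e => if z ∈ e then Sum.inr z else c e)
      (fun b u => if u = z then b = z ∨ D b w else b ≠ z ∧ D b u) := by
  set c' : Sym2 V → Fin 3 ⊕ V := fun e => if z ∈ e then Sum.inr z else c e with hc'
  have hne : ∀ t ∈ T, t ≠ z := fun t ht htz => hz (htz ▸ ht)
  have hrz := hne r h.root_mem
  have hT : T ⊆ Insert.insert z T := Finset.subset_insert z T
  have hcc : ∀ x ∈ T, ∀ y ∈ T, c' s(x, y) = c s(x, y) := by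
    intro x hx y hy
    have : ¬ z ∈ s(x, y) := by
      rw [Sym2.mem_iff]
      rintro (rfl | rfl)
      · exact hz hx
      · exact hz hy
    simp [hc', this]
  have hedge : RainbowReach G c' (Insert.insert z T) {Sum.inr z} z w :=
    .single hzw (Finset.mem_insert_self _ _) (hT hw) (by simp [hc'])
  have hreach : ∀ u ∈ T, ∀ v ∈ T,
      RainbowReach G c' (Insert.insert z T) (Sum.inr '' (↑(T.erase r) : Set V)) u v :=
    fun u hu v hv => ((h.reach u hu v hv).congr hcc).mono hT subset_rfl
  have havoid : ∀ b ∈ T, ∀ u ∈ T, ∀ v ∈ T, ¬ D b u → ¬ D b v → RainbowReach G c'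
      (Insert.insert z T) (Sum.inr '' (↑((T.erase r).erase b) : Set V)) u v :=
    fun b hb u hu v hv h1 h2 => ((h.reach_avoid b hb u hu v hv h1 h2).congr hcc).mono hT subset_rfl
  have hzreach : ∀ v ∈ T, RainbowReach G c' (Insert.insert z T)
      (Sum.inr '' (↑((Insert.insert z T).erase r) : Set V)) z v := by
    intro v hv
    refine hedge.trans' (hreach w hw v hv) ?_ ?_ ?_
    · rw [Set.disjoint_left]
      rintro _ rfl ⟨x, hx, hxz⟩
      cases hxz
      exact hz (Finset.mem_of_mem_erase hx)
    · rintro _ rfl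
      exact ⟨z, by simp [hrz.symm], rfl⟩
    · exact Set.image_mono (Finset.coe_subset.2 (Finset.erase_subset_erase _ hT))
  have hzavoid : ∀ b ∈ T, ∀ v ∈ T, ¬ D b w → ¬ D b v → RainbowReach G c' (Insert.insert z T)
      (Sum.inr '' (↑(((Insert.insert z T).erase r).erase b) : Set V)) z v := by
    intro b hb v hv h1 h2
    refine hedge.trans' (havoid b hb w hw v hv h1 h2) ?_ ?_ ?_
    · rw [Set.disjoint_left]
      rintro _ rfl ⟨x, hx, hxz⟩
      cases hxz
      exact hz (Finset.mem_of_mem_erase (Finset.mem_of_mem_erase hx))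
    · rintro _ rfl
      exact ⟨z, by simp [hrz.symm, (hne b hb).symm], rfl⟩
    · exact Set.image_mono (Finset.coe_subset.2
        (Finset.erase_subset_erase _ (Finset.erase_subset_erase _ hT)))
  refine ⟨hT h.root_mem, ?_, ?_, ?_, ?_, ?_⟩
  · rw [Finset.insert_eq, Finset.union_comm]
    refine isAcyclic_restr_union (by simpa using hz) h.acyclic (restr_singleton_isAcyclic z) w z ?_
    intro u hu v hv huv
    rw [Finset.mem_singleton] at hv
    subst hv
    exact ⟨huniq u hu huv.symm, rfl⟩
  · intro b hb b' hb' h1 h2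
    rw [Finset.mem_insert] at hb hb'
    rcases hb with rfl | hb <;> rcases hb' with rfl | hb'
    · rfl
    · simp [hne b' hb'] at h1
    · simp [hne b hb] at h2
    · simp only [hne b hb, hne b' hb', if_false, ne_eq, not_false_eq_true, true_and] at h1 h2
      exact h.antisymm b hb b' hb' h1 h2
  · intro u hu
    rw [Finset.mem_insert] at hu
    rcases hu with rfl | hu
    · simp [h.root_below w hw]
    · simp [hne u hu, hrz, h.root_below u hu]
  · intro u hu v hv
    rw [Finset.mem_insert] at hu hv
    rcases hu with rfl | hu <;> rcases hv with rfl | hv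
    · exact .nil _ _
    · exact hzreach v hv
    · exact (hzreach u hu).symm
    · exact (hreach u hu v hv).mono subset_rfl
        (Set.image_mono (Finset.coe_subset.2 (Finset.erase_subset_erase _ hT)))
  · intro b hb u hu v hv h1 h2
    rw [Finset.mem_insert] at hb hu hv
    rcases hu with rfl | hu <;> rcases hv with rfl | hv
    · exact .nil _ _
    · have h3 := hne v hv
      rcases hb with rfl | hb
      · simp at h1
      · have h4 := hne b hb
        simp only [if_true, h4, h3, if_false, false_or, ne_eq, not_false_eq_true,
          true_and] at h1 h2
        exact hzavoid b hb v hv h1 h2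
    · have h3 := hne u hu
      rcases hb with rfl | hb
      · simp at h2
      · have h4 := hne b hb
        simp only [if_true, h4, h3, if_false, false_or, ne_eq, not_false_eq_true,
          true_and] at h1 h2
        exact (hzavoid b hb u hu h2 h1).symm
    · have h3 := hne u hu
      have h4 := hne v hv
      rcases hb with rfl | hb
      · refine (hreach u hu v hv).mono subset_rfl (Set.image_mono (Finset.coe_subset.2 ?_))
        intro x hx
        have := hne x (Finset.mem_of_mem_erase hx)
        simp_all
      · have h5 := hne b hb
        simp only [h4, h3, h5, if_false, ne_eq, not_false_eq_true, true_and] at h1 h2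
        exact (havoid b hb u hu v hv h1 h2).mono subset_rfl (Set.image_mono
          (Finset.coe_subset.2 (Finset.erase_subset_erase _ (Finset.erase_subset_erase _ hT))))

lemma exists_maximal_isColoredTree {S : Finset V} {r : V} (hr : r ∈ S) :
    ∃ T ⊆ S, ∃ c D, IsColoredTree G r T c D ∧
      ∀ z ∈ S, z ∉ T → ∀ w ∈ T, G.Adj z w → ∃ w' ∈ T, G.Adj z w' ∧ w' ≠ w := by
  classical
  obtain ⟨T, hT, hmax⟩ := Finset.exists_max_image
    (S.powerset.filter fun T => ∃ c D, IsColoredTree G r T c D) Finset.card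
    ⟨{r}, by simpa using ⟨hr, _, _, isColoredTree_singleton r⟩⟩
  rw [Finset.mem_filter, Finset.mem_powerset] at hT
  obtain ⟨hTS, c, D, h⟩ := hT
  refine ⟨T, hTS, c, D, h, fun z hzS hz w hw hzw => ?_⟩
  by_contra! hcon
  have h1 := hmax (insert z T) (by
    rw [Finset.mem_filter, Finset.mem_powerset]
    exact ⟨Finset.insert_subset hzS hTS, _, _, h.insert hz hw hzw hcon⟩)
  rw [Finset.card_insert_of_notMem hz] at h1
  omega

end Tree

section Decomposition

variable {V : Type*} [DecidableEq V] {G : SimpleGraph V}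

/-- A partition of `S \ T` into connected pieces `K y`, one for each vertex `y ∈ S \ T` with a
neighbor in `T` (these vertices form the set `X`), where all other vertices in the pieces have no
neighbor in `T`. The pieces of the vertices in `J`, a set of vertices satisfying `p`, are
isolated from each other, and `J` is maximal with this property. -/
structure IsDecomposition (G : SimpleGraph V) (p : V → Prop) (S T X J : Finset V)
    (K : V → Finset V) : Prop where
  mem_X : ∀ y, y ∈ X ↔ y ∈ S ∧ y ∉ T ∧ ∃ t ∈ T, G.Adj y t
  J_subset : J ⊆ X
  J_prop : ∀ y ∈ J, p y
  self_mem : ∀ y ∈ X, y ∈ K y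
  subset : ∀ y ∈ X, ∀ u ∈ K y, u ∈ S ∧ u ∉ T
  eq_of_mem : ∀ y ∈ X, ∀ u ∈ K y, u ∈ X → u = y
  unique : ∀ y ∈ X, ∀ z ∈ X, ∀ u, u ∈ K y → u ∈ K z → y = z
  cover : ∀ u ∈ S, u ∉ T → ∃ y ∈ X, u ∈ K y
  connected : ∀ y ∈ X, ∀ u ∈ K y, (restr G (K y)).Reachable u y
  not_adj : ∀ y ∈ X, ∀ z ∈ X, y ≠ z → ∀ u ∈ K y, ∀ v ∈ K z, u ∉ X → v ∉ X → ¬ G.Adj u v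
  not_adj_J : ∀ y ∈ J, ∀ z ∈ X, y ≠ z → ∀ v ∈ K z, v ∉ X → ¬ G.Adj y v
  not_adj_JJ : ∀ y ∈ J, ∀ z ∈ J, ¬ G.Adj y z
  maximal : ∀ z ∈ X, p z → z ∉ J → ∃ t ∈ J, ∃ s ∈ K t, G.Adj z s

omit [DecidableEq V] in
lemma exists_adj_of_reachable {S T : Finset V} {r u : V} (hr : r ∈ T)
    (h : (restr G S).Reachable u r) (R : Finset V)
    (hR : ∀ v, v ∈ R ↔ v ∈ S ∧ v ∉ T ∧ ¬ ∃ t ∈ T, G.Adj v t) (hu : u ∈ R) :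
    ∃ v ∈ R, (restr G R).Reachable u v ∧ ∃ y ∈ S, y ∉ T ∧ (∃ t ∈ T, G.Adj y t) ∧ G.Adj y v := by
  rw [reachable_iff_reflTransGen] at h
  induction h using Relation.ReflTransGen.head_induction_on with
  | refl => exact absurd hr ((hR _).1 hu).2.1
  | @head a b hab _ ih =>
    by_cases hb : b ∈ R
    · obtain ⟨v, hv, hbv, hy⟩ := ih hb
      exact ⟨v, hv, (Adj.reachable (G := restr G R) ⟨hab.1, hu, hb⟩).trans hbv, hy⟩
    · have hbT : b ∉ T := fun hbT => ((hR _).1 hu).2.2 ⟨b, hbT, hab.1⟩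
      refine ⟨a, hu, Reachable.refl _, b, hab.2.2, hbT, ?_, hab.1.symm⟩
      by_contra hcon
      exact hb ((hR _).2 ⟨hab.2.2, hbT, hcon⟩)

omit [DecidableEq V] in
lemma reachable_restr_of_closed {R K : Finset V} {u v : V} (hK : u ∈ K)
    (hcl : ∀ a ∈ K, ∀ b, (restr G R).Adj a b → b ∈ K) (h : (restr G R).Reachable u v) :
    v ∈ K ∧ (restr G K).Reachable u v := by
  rw [reachable_iff_reflTransGen] at h
  induction h with
  | refl => exact ⟨hK, Reachable.refl _⟩
  | tail _ hbc ih =>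
    have hc := hcl _ ih.1 _ hbc
    exact ⟨hc, ih.2.trans (Adj.reachable (G := restr G K) ⟨hbc.1, ih.1, hc⟩)⟩

lemma exists_isDecomposition {S T : Finset V} {r : V} (p : V → Prop) (hr : r ∈ T)
    (hS : ∀ u ∈ S, (restr G S).Reachable u r) :
    ∃ X J K, IsDecomposition G p S T X J K := by
  classical
  set X := S.filter fun y => y ∉ T ∧ ∃ t ∈ T, G.Adj y t with hX
  set R := S.filter fun y => y ∉ T ∧ ¬ ∃ t ∈ T, G.Adj y t with hR
  have memX : ∀ y, y ∈ X ↔ y ∈ S ∧ y ∉ T ∧ ∃ t ∈ T, G.Adj y t := fun y => Finset.mem_filter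
  have memR : ∀ y, y ∈ R ↔ y ∈ S ∧ y ∉ T ∧ ¬ ∃ t ∈ T, G.Adj y t := fun y => Finset.mem_filter
  have hXR : ∀ y ∈ X, y ∉ R := fun y hy hy' => ((memR y).1 hy').2.2 ((memX y).1 hy).2.2
  have hcov : ∀ u ∈ S, u ∉ T → u ∈ X ∨ u ∈ R := by
    intro u hu hT
    by_cases h : ∃ t ∈ T, G.Adj u t
    · exact Or.inl ((memX u).2 ⟨hu, hT, h⟩)
    · exact Or.inr ((memR u).2 ⟨hu, hT, h⟩)
  let comp := (restr G R).connectedComponentMk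
  let touch : V → (restr G R).ConnectedComponent → Prop :=
    fun y C => ∃ v ∈ R, comp v = C ∧ G.Adj y v
  have htouch : ∀ u ∈ R, ∃ y ∈ X, touch y (comp u) := by
    intro u hu
    obtain ⟨v, hv, huv, y, hyS, hyT, hyt, hyv⟩ :=
      exists_adj_of_reachable hr (hS u ((memR u).1 hu).1) R memR hu
    exact ⟨y, (memX y).2 ⟨hyS, hyT, hyt⟩, v, hv, ConnectedComponent.sound huv.symm, hyv⟩
  let Q : Finset V → Prop := fun J =>
    ∀ y ∈ J, ∀ z ∈ J, y ≠ z → ¬ G.Adj y z ∧ ∀ C, ¬ (touch y C ∧ touch z C)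
  obtain ⟨J, hJ, hJmax⟩ := Finset.exists_max_image ((X.filter p).powerset.filter Q) Finset.card
    ⟨∅, by simp [Q]⟩
  rw [Finset.mem_filter, Finset.mem_powerset] at hJ
  obtain ⟨hJX, hJ⟩ := hJ
  have hJX' : J ⊆ X := hJX.trans (Finset.filter_subset _ _)
  have hκ : ∀ C, ∃ y, (∀ z ∈ J, touch z C → y = z) ∧
      ((∃ z ∈ X, touch z C) → y ∈ X ∧ touch y C) := by
    intro C
    by_cases h1 : ∃ y ∈ J, touch y C
    · obtain ⟨y, hy, hyC⟩ := h1
      refine ⟨y, fun z hz hzC => ?_, fun _ => ⟨hJX' hy, hyC⟩⟩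
      by_contra hne
      exact (hJ y hy z hz hne).2 C ⟨hyC, hzC⟩
    · by_cases h2 : ∃ y ∈ X, touch y C
      · obtain ⟨y, hy, hyC⟩ := h2
        exact ⟨y, fun z hz hzC => absurd ⟨z, hz, hzC⟩ h1, fun _ => ⟨hy, hyC⟩⟩
      · exact ⟨r, fun z hz hzC => absurd ⟨z, hz, hzC⟩ h1, fun h => absurd h h2⟩
  choose κ hκJ hκX using hκ
  have memK : ∀ y u, u ∈ insert y (R.filter fun u => κ (comp u) = y) ↔
      u = y ∨ (u ∈ R ∧ κ (comp u) = y) := by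
    intro y u
    rw [Finset.mem_insert, Finset.mem_filter]
  have hadj : ∀ u ∈ R, ∀ v ∈ R, G.Adj u v → comp u = comp v := fun u hu v hv huv =>
    ConnectedComponent.sound (Adj.reachable (G := restr G R) ⟨huv, hu, hv⟩)
  refine ⟨X, J, fun y => insert y (R.filter fun u => κ (comp u) = y),
    memX, hJX', fun y hy => (Finset.mem_filter.1 (hJX hy)).2,
    fun y _ => Finset.mem_insert_self _ _, ?_, ?_, ?_, ?_, ?_, ?_, ?_, ?_, ?_⟩
  · intro y hy u hu
    rcases (memK y u).1 hu with rfl | ⟨hu, -⟩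
    · exact ⟨((memX u).1 hy).1, ((memX u).1 hy).2.1⟩
    · exact ⟨((memR u).1 hu).1, ((memR u).1 hu).2.1⟩
  · intro y hy u hu huX
    rcases (memK y u).1 hu with rfl | ⟨hu, -⟩
    · rfl
    · exact absurd hu (hXR u huX)
  · intro y hy z hz u hu hu'
    rcases (memK y u).1 hu with rfl | ⟨hu, h1⟩ <;> rcases (memK z u).1 hu' with rfl | ⟨hu', h2⟩
    · rfl
    · exact absurd hu' (hXR u hy)
    · exact absurd hu (hXR u hz)
    · rw [← h1, h2]
  · intro u hu hT
    rcases hcov u hu hT with h | h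
    · exact ⟨u, h, Finset.mem_insert_self _ _⟩
    · exact ⟨κ (comp u), (hκX _ (htouch u h)).1, (memK _ _).2 (Or.inr ⟨h, rfl⟩)⟩
  · intro y hy u hu
    have hu0 := hu
    rcases (memK y u).1 hu with rfl | ⟨huR, h1⟩
    · exact Reachable.refl _
    · obtain ⟨v, hv, hvC, hyv⟩ := (hκX _ (htouch u huR)).2
      rw [h1] at hyv
      have huv : (restr G R).Reachable u v := (ConnectedComponent.exact hvC).symm
      have hsub : R.filter (fun u => κ (comp u) = y) ⊆
        insert y (R.filter fun u => κ (comp u) = y) := Finset.subset_insert _ _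
      obtain ⟨hvK, hreach⟩ := reachable_restr_of_closed
        (K := R.filter (fun u => κ (comp u) = y)) (Finset.mem_filter.2 ⟨huR, h1⟩)
        (fun a ha b hab => by
          rw [Finset.mem_filter] at ha ⊢
          exact ⟨hab.2.2, by rw [← hadj a ha.1 b hab.2.2 hab.1, ha.2]⟩) huv
      refine (hreach.mono (restr_mono hsub)).trans (Adj.reachable ?_)
      exact ⟨hyv.symm, hsub hvK, Finset.mem_insert_self _ _⟩
  · intro y hy z hz hyz u hu v hv huX hvX huv
    rcases (memK y u).1 hu with rfl | ⟨hu, h1⟩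
    · exact huX hy
    rcases (memK z v).1 hv with rfl | ⟨hv, h2⟩
    · exact hvX hz
    rw [hadj u hu v hv huv, h2] at h1
    exact hyz h1.symm
  · intro y hy z hz hyz v hv hvX hyv
    rcases (memK z v).1 hv with rfl | ⟨hv, h2⟩
    · exact hvX hz
    rw [hκJ (comp v) y hy ⟨v, hv, rfl, hyv⟩] at h2
    exact hyz h2
  · intro y hy z hz hyz
    exact (hJ y hy z hz hyz.ne).1 hyz
  · intro z hz hpz hzJ
    by_contra! hcon
    have hzz : ∀ y ∈ J, ¬ G.Adj z y ∧ ∀ C, ¬ (touch z C ∧ touch y C) := by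
      intro y hy
      refine ⟨hcon y hy y (Finset.mem_insert_self _ _), ?_⟩
      rintro C ⟨⟨v, hv, rfl, hzv⟩, hyC⟩
      exact hcon y hy v ((memK _ _).2 (Or.inr ⟨hv, hκJ _ y hy hyC⟩)) hzv
    have h1 := hJmax (insert z J) (by
      rw [Finset.mem_filter, Finset.mem_powerset]
      refine ⟨Finset.insert_subset (Finset.mem_filter.2 ⟨hz, hpz⟩) hJX, ?_⟩
      intro a ha b hb hab
      rw [Finset.mem_insert] at ha hb
      rcases ha with rfl | ha <;> rcases hb with rfl | hb
      · exact absurd rfl hab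
      · exact hzz b hb
      · exact ⟨fun h => (hzz a ha).1 h.symm, fun C hC => (hzz a ha).2 C hC.symm⟩
      · exact hJ a ha b hb hab)
    rw [Finset.card_insert_of_notMem hzJ] at h1
    omega

end Decomposition

section Step

variable {V : Type*} [DecidableEq V] {G : SimpleGraph V}

/-- An induced forest `F ⊆ S` together with a rainbow coloring `c` of the graph induced on `S`
that uses fewer than `#F` private colors from `P ⊆ S` and three shared colors, where the shared
colors are not needed for reaching `r`. -/
structure IsRainbowForest (G : SimpleGraph V) (S : Finset V) (r : V) (F P : Finset V)
    (c : Sym2 V → Fin 3 ⊕ V) : Prop where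
  forest_subset : F ⊆ S
  root_mem : r ∈ F
  acyclic : (restr G F).IsAcyclic
  palette_subset : P ⊆ S
  root_notMem : r ∉ P
  card_lt : P.card + 1 ≤ F.card
  up : ∀ u ∈ S, RainbowReach G c S (Sum.inr '' (P : Set V)) u r
  reach : ∀ u ∈ S, ∀ v ∈ S, RainbowReach G c S (Set.range Sum.inl ∪ Sum.inr '' (P : Set V)) u v

namespace IsDecomposition

variable {p : V → Prop} {S T X J : Finset V} {K : V → Finset V}

omit [DecidableEq V] in
lemma disjoint_pieces (h : IsDecomposition G p S T X J K) {y z : V} (hy : y ∈ X) (hz : z ∈ X)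
    (hyz : y ≠ z) : Disjoint (K y) (K z) :=
  Finset.disjoint_left.2 fun u hu hu' => hyz (h.unique y hy z hz u hu hu')

omit [DecidableEq V] in
lemma disjoint_tree (h : IsDecomposition G p S T X J K) {y : V} (hy : y ∈ X) :
    Disjoint T (K y) :=
  Finset.disjoint_right.2 fun u hu => (h.subset y hy u hu).2

lemma isAcyclic_forest (h : IsDecomposition G p S T X J K) (hT : (restr G T).IsAcyclic)
    {F : V → Finset V} (hFK : ∀ y ∈ X, F y ⊆ K y)
    (hF : ∀ y ∈ X, (restr G (F y)).IsAcyclic) {a b : V → V}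
    (hab : ∀ y ∈ J, ∀ t ∈ T, G.Adj y t → t = a y ∨ t = b y) :
    (restr G ((T \ J.image b) ∪
      X.biUnion fun y => if y ∈ J then F y else (F y).erase y)).IsAcyclic := by
  have hsub : ∀ y, (if y ∈ J then F y else (F y).erase y) ⊆ F y := by
    intro y
    split_ifs
    · exact subset_rfl
    · exact Finset.erase_subset _ _
  have hmem : ∀ y ∈ X, ∀ u ∈ (if y ∈ J then F y else (F y).erase y),
      u ∈ K y ∧ ((u = y ∧ y ∈ J) ∨ u ∉ X) := by
    intro y hy u hu
    have huK := hFK y hy (hsub y hu)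
    refine ⟨huK, ?_⟩
    by_cases huX : u ∈ X
    · obtain rfl := h.eq_of_mem y hy u huK huX
      refine Or.inl ⟨rfl, ?_⟩
      by_contra hJ
      simp [hJ] at hu
    · exact Or.inr huX
  refine isAcyclic_restr_union_biUnion X _ (hT.anti (restr_mono Finset.sdiff_subset))
    (fun y hy => (hF y hy).anti (restr_mono (hsub y))) ?_ ?_ a id ?_ ?_
  · intro y hy
    exact (h.disjoint_tree hy).mono Finset.sdiff_subset ((hsub y).trans (hFK y hy))
  · intro y hy z hz hyz
    exact (h.disjoint_pieces hy hz hyz).mono ((hsub y).trans (hFK y hy))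
      ((hsub z).trans (hFK z hz))
  · intro y hy u hu v hv huv
    rw [Finset.mem_sdiff, Finset.mem_image, not_exists] at hu
    obtain ⟨hvK, ⟨rfl, hJ⟩ | hvX⟩ := hmem y hy v hv
    · rcases hab v hJ u hu.1 huv.symm with h1 | h1
      · exact ⟨h1, rfl⟩
      · exact absurd ⟨hJ, h1.symm⟩ (hu.2 v)
    · exact absurd ((h.mem_X v).2 ⟨(h.subset y hy v hvK).1, (h.subset y hy v hvK).2, u, hu.1,
        huv.symm⟩) hvX
  · intro y hy z hz hyz u hu v hv huv
    obtain ⟨huK, ⟨rfl, hJ⟩ | huX⟩ := hmem y hy u hu <;>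
      obtain ⟨hvK, ⟨rfl, hJ'⟩ | hvX⟩ := hmem z hz v hv
    · exact h.not_adj_JJ u hJ v hJ' huv
    · exact h.not_adj_J u hJ z hz hyz v hvK hvX huv
    · exact h.not_adj_J v hJ' y hy hyz.symm u huK huX huv.symm
    · exact h.not_adj y hy z hz hyz u huK v hvK huX hvX huv

lemma card_forest (h : IsDecomposition G p S T X J K)
    {F : V → Finset V} (hFK : ∀ y ∈ X, F y ⊆ K y) (hFy : ∀ y ∈ X, y ∈ F y) {b : V → V}
    (hb : ∀ y ∈ J, b y ∈ T) :
    T.card + ∑ y ∈ X, ((F y).card - 1) + J.card ≤ ((T \ J.image b) ∪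
      X.biUnion fun y => if y ∈ J then F y else (F y).erase y).card + (J.image b).card := by
  have hsub : ∀ y, (if y ∈ J then F y else (F y).erase y) ⊆ F y := by
    intro y
    split_ifs
    · exact subset_rfl
    · exact Finset.erase_subset _ _
  rw [Finset.card_union_of_disjoint, Finset.card_biUnion, Finset.card_sdiff_of_subset]
  · have h1 : ∀ y ∈ X, (if y ∈ J then F y else (F y).erase y).card =
        ((F y).card - 1) + if y ∈ J then 1 else 0 := by
      intro y hy
      have := Finset.card_pos.2 ⟨y, hFy y hy⟩
      split_ifs
      · omega
      · rw [Finset.card_erase_of_mem (hFy y hy)]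
        rfl
    rw [Finset.sum_congr rfl h1, Finset.sum_add_distrib, ← Finset.sum_filter,
      Finset.filter_mem_eq_inter, Finset.inter_eq_right.2 h.J_subset, Finset.sum_const,
      smul_eq_mul, mul_one]
    have : (J.image b).card ≤ T.card := Finset.card_le_card (Finset.image_subset_iff.2 hb)
    omega
  · exact Finset.image_subset_iff.2 hb
  · intro y hy z hz hyz
    exact (h.disjoint_pieces hy hz hyz).mono ((hsub y).trans (hFK y hy))
      ((hsub z).trans (hFK z hz))
  · rw [Finset.disjoint_biUnion_right]
    intro y hy
    exact (h.disjoint_tree hy).mono Finset.sdiff_subset ((hsub y).trans (hFK y hy))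

omit [DecidableEq V] in
/-- Colorings of the tree, of the pieces and of the edges between the tree and `X` can be glued,
with color `k` for the remaining edges. -/
lemma exists_coloring {C : Type*} (h : IsDecomposition G p S T X J K) (cT : Sym2 V → C)
    (cK : V → Sym2 V → C) (d : V → V → C) (k : C) :
    ∃ c : Sym2 V → C, (∀ x ∈ T, ∀ y ∈ T, c s(x, y) = cT s(x, y)) ∧
      (∀ y ∈ X, ∀ u ∈ K y, ∀ v ∈ K y, c s(u, v) = cK y s(u, v)) ∧
      (∀ y ∈ X, ∀ t ∈ T, c s(y, t) = d y t) ∧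
      (∀ y ∈ X, ∀ z ∈ X, y ≠ z → ∀ v ∈ K z, c s(y, v) = k) := by
  classical
  have hXT : ∀ y ∈ X, y ∉ T := fun y hy => ((h.mem_X y).1 hy).2.1
  have hKT : ∀ y ∈ X, ∀ u ∈ K y, u ∉ T := fun y hy u hu => (h.subset y hy u hu).2
  let c : Sym2 V → C := fun e =>
    if ∀ x ∈ e, x ∈ T then cT e
    else if h1 : ∃ y ∈ X, ∀ x ∈ e, x ∈ K y then cK h1.choose e
    else if h2 : ∃ q : V × V, q.1 ∈ X ∧ q.2 ∈ T ∧ e = s(q.1, q.2) then d h2.choose.1 h2.choose.2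
    else k
  refine ⟨c, ?_, ?_, ?_, ?_⟩
  · intro x hx y hy
    have : ∀ w ∈ s(x, y), w ∈ T := by
      intro w hw
      rcases Sym2.mem_iff.1 hw with rfl | rfl <;> assumption
    simp only [c, if_pos this]
  · intro y hy u hu v hv
    have h0 : ¬ ∀ w ∈ s(u, v), w ∈ T := fun hw => hKT y hy u hu (hw u (Sym2.mem_mk_left u v))
    have h1 : ∃ z ∈ X, ∀ w ∈ s(u, v), w ∈ K z := by
      refine ⟨y, hy, fun w hw => ?_⟩
      rcases Sym2.mem_iff.1 hw with rfl | rfl <;> assumption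
    have h2 : h1.choose = y := h.unique _ h1.choose_spec.1 y hy u
      (h1.choose_spec.2 u (Sym2.mem_mk_left u v)) hu
    simp only [c, if_neg h0, dif_pos h1, h2]
  · intro y hy t ht
    have h0 : ¬ ∀ w ∈ s(y, t), w ∈ T := fun hw => hXT y hy (hw y (Sym2.mem_mk_left y t))
    have h1 : ¬ ∃ z ∈ X, ∀ w ∈ s(y, t), w ∈ K z := by
      rintro ⟨z, hz, hw⟩
      exact hKT z hz t (hw t (Sym2.mem_mk_right y t)) ht
    have h2 : ∃ q : V × V, q.1 ∈ X ∧ q.2 ∈ T ∧ s(y, t) = s(q.1, q.2) := ⟨(y, t), hy, ht, rfl⟩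
    have h3 : h2.choose.1 = y ∧ h2.choose.2 = t := by
      obtain ⟨hq1, hq2, hq⟩ := h2.choose_spec
      rcases Sym2.eq_iff.1 hq with hq | hq
      · exact ⟨hq.1.symm, hq.2.symm⟩
      · exact absurd (hq.1 ▸ hq2) (hXT y hy)
    simp only [c, if_neg h0, dif_neg h1, dif_pos h2, h3.1, h3.2]
  · intro y hy z hz hyz v hv
    have h0 : ¬ ∀ w ∈ s(y, v), w ∈ T := fun hw => hXT y hy (hw y (Sym2.mem_mk_left y v))
    have h1 : ¬ ∃ z ∈ X, ∀ w ∈ s(y, v), w ∈ K z := by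
      rintro ⟨x, hx, hw⟩
      have h2 := h.unique x hx z hz v (hw v (Sym2.mem_mk_right y v)) hv
      have h3 := h.eq_of_mem x hx y (hw y (Sym2.mem_mk_left y v)) hy
      exact hyz (h3.trans h2)
    have h2 : ¬ ∃ q : V × V, q.1 ∈ X ∧ q.2 ∈ T ∧ s(y, v) = s(q.1, q.2) := by
      rintro ⟨q, hq1, hq2, hq⟩
      rcases Sym2.eq_iff.1 hq with hq | hq
      · exact hKT z hz v hv (hq.2 ▸ hq2)
      · exact hXT y hy (hq.1 ▸ hq2)
    simp only [c, if_neg h0, dif_neg h1, dif_neg h2]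

end IsDecomposition

/-- Two vertices outside a colored tree, each attached to it by two edges, are joined through the
tree by neutral colors (those in `Q`), possibly together with the colors of a third piece. -/
lemma IsColoredTree.reach_attached {r : V} {S T X J : Finset V} {c cT : Sym2 V → Fin 3 ⊕ V}
    {D : V → V → Prop} (hT : IsColoredTree G r T cT D)
    (htree : ∀ u ∈ T, ∀ v ∈ T, RainbowReach G c S (Sum.inr '' (↑(T.erase r) : Set V)) u v)
    (havoid : ∀ b ∈ T, ∀ u ∈ T, ∀ v ∈ T, ¬ D b u → ¬ D b v →
      RainbowReach G c S (Sum.inr '' (↑((T.erase r).erase b) : Set V)) u v)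
    {a b : V → V} {e : V → Fin 3 ⊕ V} {Q : Set (Fin 3 ⊕ V)} {B : V → Set (Fin 3 ⊕ V)}
    (haT : ∀ y ∈ X, a y ∈ T) (hbT : ∀ y ∈ X, b y ∈ T) (hbr : ∀ y ∈ X, b y ≠ r)
    (hD : ∀ y ∈ X, ¬ D (b y) (a y))
    (ha : ∀ y ∈ X, RainbowReach G c S {Sum.inr (b y)} y (a y))
    (hb : ∀ y ∈ X, RainbowReach G c S {e y} y (b y))
    (hQT : Sum.inr '' (↑(T.erase r) : Set V) ⊆ Q) (hQ : ∀ n, Sum.inl n ∈ Q)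
    (heQ : ∀ y ∈ X, e y ∈ Q) (heT : ∀ y ∈ X, e y ∉ Sum.inr '' (↑(T.erase r) : Set V))
    (hBQ : ∀ y ∈ X, Disjoint Q (B y))
    (h0 : ∀ y ∈ X, e y = Sum.inl 0 → ∃ t ∈ X, e t ≠ Sum.inl 0 ∧ e t ≠ Sum.inl 2 ∧
      ∃ s, RainbowReach G c S {Sum.inl 2} y s ∧ RainbowReach G c S (B t) s t)
    (h1 : ∀ y ∈ X, e y = Sum.inl 1 → y ∈ J ∨ ∃ d ∈ T, RainbowReach G c S {Sum.inl 0} y d)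
    (hJ : ∀ y ∈ J, ∀ z ∈ J, e y = Sum.inl 1 → e z = Sum.inl 1 → b y = b z → y = z)
    (he : ∀ y ∈ X, ∀ z ∈ X, y ≠ z → e y = e z → e y = Sum.inl 0 ∨ e y = Sum.inl 1)
    {i j : V} (hi : i ∈ X) (hj : j ∈ X) (hij : i ≠ j) :
    RainbowReach G c S Q i j ∨ ∃ t ∈ X, t ≠ i ∧ t ≠ j ∧ RainbowReach G c S (Q ∪ B t) i j := by
  have hlT : ∀ n : Fin 3, (Sum.inl n : Fin 3 ⊕ V) ∉ Sum.inr '' (↑(T.erase r) : Set V) := by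
    rintro n ⟨x, -, hx⟩
    cases hx
  have hsub : ∀ x, (Sum.inr '' (↑((T.erase r).erase x) : Set V) : Set (Fin 3 ⊕ V)) ⊆
      Sum.inr '' (↑(T.erase r) : Set V) := fun x =>
    Set.image_mono (Finset.coe_subset.2 (Finset.erase_subset _ _))
  have key1 : ∀ i ∈ X, ∀ j ∈ X, ¬ D (b j) (b i) → RainbowReach G c S Q i j := by
    intro i hi j hj hd
    have h2 : RainbowReach G c S _ (b i) (a j) :=
      havoid (b j) (hbT j hj) _ (hbT i hi) _ (haT j hj) hd (hD j hj)
    have h3 : RainbowReach G c S (Sum.inr '' (↑(T.erase r) : Set V)) (b i) j := by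
      refine h2.trans' (ha j hj).symm ?_ (hsub _) ?_
      · rw [Set.disjoint_singleton_right]
        rintro ⟨x, hx, hxj⟩
        simp_all
      · rw [Set.singleton_subset_iff]
        exact ⟨b j, by simp [hbr j hj, hbT j hj], rfl⟩
    refine (hb i hi).trans' h3 ?_ (Set.singleton_subset_iff.2 (heQ i hi)) hQT
    rw [Set.disjoint_singleton_left]
    exact heT i hi
  have key2 : ∀ i ∈ X, ∀ j ∈ X, e j = Sum.inl 1 → (∃ d ∈ T, RainbowReach G c S {Sum.inl 0} i d) →
      RainbowReach G c S Q i j := by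
    rintro i hi j hj hej ⟨d, hd, hid⟩
    have h2 : RainbowReach G c S (Q \ {Sum.inl 0}) d j := by
      refine (htree d hd (b j) (hbT j hj)).trans' (hb j hj).symm ?_ ?_ ?_
      · rw [Set.disjoint_singleton_right]
        exact heT j hj
      · exact Set.subset_sdiff_singleton hQT (hlT 0)
      · rw [Set.singleton_subset_iff]
        exact ⟨heQ j hj, by simp [hej]⟩
    exact hid.trans' h2 Set.disjoint_sdiff_right (Set.singleton_subset_iff.2 (hQ 0))
      Set.sdiff_subset
  by_cases hbb : b i = b j
  · by_cases hee : e i = e j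
    · rcases he i hi j hj hij hee with h | h
      · right
        obtain ⟨t, ht, ht0, ht2, s, hs, hst⟩ := h0 i hi h
        refine ⟨t, ht, ?_, ?_, ?_⟩
        · rintro rfl
          exact ht0 h
        · rintro rfl
          exact ht0 (hee ▸ h)
        · have h3 : RainbowReach G c S (Q \ {Sum.inl 2, e t}) (b t) j := by
            refine (htree _ (hbT t ht) _ (hbT j hj)).trans' (hb j hj).symm ?_ ?_ ?_
            · rw [Set.disjoint_singleton_right]
              exact heT j hj
            · intro x hx
              refine ⟨hQT hx, ?_⟩
              rintro (rfl | rfl)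
              · exact hlT 2 hx
              · exact heT t ht hx
            · rw [Set.singleton_subset_iff]
              refine ⟨heQ j hj, ?_⟩
              rw [← hee, h]
              rintro (h4 | h4)
              · simp at h4
              · exact ht0 h4.symm
          have h4 : RainbowReach G c S (Q \ {Sum.inl 2}) t j := by
            refine (hb t ht).trans' h3 ?_ ?_ ?_
            · rw [Set.disjoint_singleton_left]
              simp
            · rw [Set.singleton_subset_iff]
              exact ⟨heQ t ht, ht2⟩
            · exact Set.sdiff_subset_sdiff_right (by simp)
          have h5 : RainbowReach G c S ((Q \ {Sum.inl 2}) ∪ B t) s j :=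
            hst.trans' h4 ((hBQ t ht).symm.mono_right Set.sdiff_subset) Set.subset_union_right
              Set.subset_union_left
          refine hs.trans' h5 ?_ ?_ ?_
          · rw [Set.disjoint_singleton_left]
            rintro (hx | hx)
            · exact hx.2 rfl
            · exact Set.disjoint_left.1 (hBQ t ht) (hQ 2) hx
          · rw [Set.singleton_subset_iff]
            exact Or.inl (hQ 2)
          · exact Set.union_subset_union_left _ Set.sdiff_subset
      · left
        rcases h1 i hi h with h2 | h2
        · rcases h1 j hj (hee ▸ h) with h3 | h3
          · exact absurd (hJ i h2 j h3 h (hee ▸ h) hbb) hij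
          · exact (key2 j hj i hi h h3).symm
        · exact key2 i hi j hj (hee ▸ h) h2
    · left
      refine (hb i hi).trans' (hbb ▸ (hb j hj).symm) ?_ (Set.singleton_subset_iff.2 (heQ i hi))
        (Set.singleton_subset_iff.2 (heQ j hj))
      rw [Set.disjoint_singleton]
      exact hee
  · left
    by_cases hd : D (b j) (b i)
    · exact (key1 j hj i hi fun hd' => hbb (hT.antisymm _ (hbT i hi) _ (hbT j hj) hd' hd)).symm
    · exact key1 i hi j hj hd

lemma IsDecomposition.card_palette {p : V → Prop} {S T X J : Finset V} {K : V → Finset V}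
    (h : IsDecomposition G p S T X J K) {r : V} (hr : r ∈ T) {F P : V → Finset V}
    (hFK : ∀ y ∈ X, F y ⊆ K y) (hFy : ∀ y ∈ X, y ∈ F y)
    (hP : ∀ y ∈ X, (P y).card + 1 ≤ (F y).card) {b g : V → V} (hb : ∀ y ∈ J, b y ∈ T)
    (hg : ∀ y ∈ J, g (b y) ∈ J ∧ b (g (b y)) = b y) :
    (T.erase r ∪ X.biUnion P ∪ J.filter fun y => g (b y) ≠ y).card + 1 ≤ ((T \ J.image b) ∪
      X.biUnion fun y => if y ∈ J then F y else (F y).erase y).card := by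
  have h1 := h.card_forest hFK hFy hb
  have h2 : (J.image b).card ≤ (J.filter fun y => g (b y) = y).card := by
    refine (Finset.card_le_card ?_).trans (Finset.card_image_le (f := b))
    intro x hx
    obtain ⟨y, hy, rfl⟩ := Finset.mem_image.1 hx
    refine Finset.mem_image.2 ⟨g (b y), Finset.mem_filter.2 ⟨(hg y hy).1, ?_⟩, (hg y hy).2⟩
    rw [(hg y hy).2]
  have h3 := Finset.card_filter_add_card_filter_not (s := J) (fun y => g (b y) = y)
  have h4 : (X.biUnion P).card ≤ ∑ y ∈ X, ((F y).card - 1) :=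
    Finset.card_biUnion_le.trans (Finset.sum_le_sum fun y hy => Nat.le_sub_of_add_le (hP y hy))
  have h5 := Finset.card_union_le (T.erase r ∪ X.biUnion P) (J.filter fun y => g (b y) ≠ y)
  have h6 := Finset.card_union_le (T.erase r) (X.biUnion P)
  have h7 := Finset.card_erase_add_one hr
  simp only [ne_eq] at h5 ⊢
  omega

/-- Every connected induced subgraph has a rainbow forest. -/
lemma exists_isRainbowForest (S : Finset V) {r : V} (hr : r ∈ S)
    (hS : ∀ u ∈ S, (restr G S).Reachable u r) :
    ∃ F P c, IsRainbowForest G S r F P c := by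
  induction S using Finset.strongInduction generalizing r with
  | H S ih =>
  obtain ⟨T, hTS, cT, D, hT, hTmax⟩ := exists_maximal_isColoredTree (G := G) hr
  obtain ⟨X, J, K, h⟩ := exists_isDecomposition
    (fun y => ∃ a b, ∀ t ∈ T, G.Adj y t → t = a ∨ t = b) hT.root_mem hS
  have hrK : ∀ y ∈ X, r ∉ K y := fun y hy hrK => (h.subset y hy r hrK).2 hT.root_mem
  have hKS : ∀ y ∈ X, K y ⊆ S := fun y hy u hu => (h.subset y hy u hu).1
  have hXS : ∀ y ∈ X, y ∈ S := fun y hy => ((h.mem_X y).1 hy).1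
  have hXT : ∀ y ∈ X, y ∉ T := fun y hy => ((h.mem_X y).1 hy).2.1
  have hIH : ∀ y ∈ X, ∃ F P c, IsRainbowForest G (K y) y F P c := fun y hy =>
    ih (K y) ((hKS y hy).ssubset_of_ne fun he => hrK y hy (he ▸ hr)) (h.self_mem y hy)
      (h.connected y hy)
  choose! F P cK hF using hIH
  have hab : ∀ y ∈ X, ∃ a b, a ∈ T ∧ b ∈ T ∧ G.Adj y a ∧ G.Adj y b ∧ b ≠ a ∧ ¬ D b a ∧
      ((∃ a b, ∀ t ∈ T, G.Adj y t → t = a ∨ t = b) → ∀ t ∈ T, G.Adj y t → t = a ∨ t = b) := by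
    intro y hy
    obtain ⟨hyS, hyT, w, hw, hyw⟩ := (h.mem_X y).1 hy
    obtain ⟨w', hw', hyw', hne⟩ := hTmax y hyS hyT w hw hyw
    have hp : (∃ a b, ∀ t ∈ T, G.Adj y t → t = a ∨ t = b) →
        ∀ t ∈ T, G.Adj y t → t = w ∨ t = w' := by
      rintro ⟨a, b, hab⟩ t ht hyt
      have h1 := hab w hw hyw
      have h2 := hab w' hw' hyw'
      have h3 := hab t ht hyt
      grind
    by_cases hd : D w' w
    · refine ⟨w', w, hw', hw, hyw', hyw, hne.symm, fun hd' => hne (hT.antisymm _ hw' _ hw hd hd'),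
        fun hh t ht hyt => (hp hh t ht hyt).symm⟩
    · exact ⟨w, w', hw, hw', hyw, hyw', hne, hd, hp⟩
  choose! a b haT hbT hya hyb hne hD habp using hab
  have hbr : ∀ y ∈ X, b y ≠ r := fun y hy hbr => hD y hy (hbr ▸ hT.root_below _ (haT y hy))
  have hg : ∃ g : V → V, ∀ y ∈ J, g (b y) ∈ J ∧ b (g (b y)) = b y := by
    have : ∀ x, ∃ z, ∀ y ∈ J, b y = x → z ∈ J ∧ b z = x := by
      intro x
      by_cases hx : ∃ z ∈ J, b z = x
      · obtain ⟨z, hz⟩ := hx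
        exact ⟨z, fun _ _ _ => hz⟩
      · exact ⟨x, fun y hy hyx => absurd ⟨y, hy, hyx⟩ hx⟩
    choose g hg using this
    exact ⟨g, fun y hy => hg _ y hy rfl⟩
  obtain ⟨g, hg⟩ := hg
  classical
  let e : V → Fin 3 ⊕ V := fun y =>
    if y ∈ J then (if g (b y) = y then Sum.inl 1 else Sum.inr y)
    else if ∃ a b, ∀ t ∈ T, G.Adj y t → t = a ∨ t = b then Sum.inl 0 else Sum.inl 1
  obtain ⟨c, hcT, hcK, hcd, hck⟩ := h.exists_coloring cT cK
    (fun y t => if t = a y then Sum.inr (b y) else if t = b y then e y else Sum.inl 0) (Sum.inl 2)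
  have he0 : ∀ y ∈ X, e y = Sum.inl 0 →
      y ∉ J ∧ ∃ a b, ∀ t ∈ T, G.Adj y t → t = a ∨ t = b := by
    intro y hy hey
    simp only [e] at hey
    split_ifs at hey with h1 h2 h3
    · simp at hey
    · exact ⟨h1, h3⟩
    · simp at hey
  have he1 : ∀ y ∈ X, e y = Sum.inl 1 → (y ∈ J ∧ g (b y) = y) ∨
      ¬ ∃ a b, ∀ t ∈ T, G.Adj y t → t = a ∨ t = b := by
    intro y hy hey
    simp only [e] at hey
    split_ifs at hey with h1 h2 h3
    · exact Or.inl ⟨h1, h2⟩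
    · simp at hey
    · exact Or.inr h3
  have heJ : ∀ y ∈ X, e y = Sum.inl 0 ∨ e y = Sum.inl 1 ∨
      e y = Sum.inr y ∧ y ∈ J ∧ g (b y) ≠ y := by
    intro y hy
    simp only [e]
    split_ifs with h1 h2 h3 <;> simp [*]
  have hPK : ∀ y ∈ X, ∀ x ∈ P y, x ∈ K y ∧ x ≠ y := fun y hy x hx =>
    ⟨(hF y hy).palette_subset hx, fun hxy => (hF y hy).root_notMem (hxy ▸ hx)⟩
  set PP := T.erase r ∪ X.biUnion P ∪ J.filter fun y => g (b y) ≠ y with hPP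
  let B : V → Set (Fin 3 ⊕ V) := fun y => Sum.inr '' (P y : Set V)
  let A : Set (Fin 3 ⊕ V) := Set.range Sum.inl ∪ Sum.inr '' (PP : Set V)
  let Q : Set (Fin 3 ⊕ V) := {k | k ∈ A ∧ ∀ y ∈ X, k ∉ B y}
  have hBA : ∀ y ∈ X, B y ⊆ Sum.inr '' (PP : Set V) := by
    intro y hy
    refine Set.image_mono fun x hx => ?_
    simp only [hPP, Finset.coe_union, Finset.coe_biUnion]
    exact Or.inl (Or.inr (Set.mem_biUnion hy hx))
  have hQA : Q ⊆ A := fun k hk => hk.1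
  have hBQ : ∀ y ∈ X, Disjoint Q (B y) := fun y hy =>
    Set.disjoint_left.2 fun k hk => hk.2 y hy
  have hBB : ∀ y ∈ X, ∀ z ∈ X, y ≠ z → Disjoint (B y) (B z) := by
    intro y hy z hz hyz
    rw [Set.disjoint_left]
    rintro _ ⟨x, hx, rfl⟩ ⟨x', hx', hxx⟩
    obtain rfl := Sum.inr_injective hxx
    exact hyz (h.unique y hy z hz _ (hPK y hy _ hx).1 (hPK z hz _ hx').1)
  have hQl : ∀ n, Sum.inl n ∈ Q := by
    refine fun n => ⟨Or.inl ⟨n, rfl⟩, fun y hy => ?_⟩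
    rintro ⟨x, -, hx⟩
    cases hx
  have hTP : (Sum.inr '' (↑(T.erase r) : Set V) : Set (Fin 3 ⊕ V)) ⊆ Sum.inr '' (PP : Set V) := by
    refine Set.image_mono (Finset.coe_subset.2 ?_)
    rw [hPP, Finset.union_assoc]
    exact Finset.subset_union_left
  have hQT : (Sum.inr '' (↑(T.erase r) : Set V) : Set (Fin 3 ⊕ V)) ⊆ Q := by
    intro k hk
    refine ⟨Or.inr (hTP hk), ?_⟩
    obtain ⟨x, hx, rfl⟩ := hk
    rintro y hy ⟨x', hx', hxx⟩
    obtain rfl := Sum.inr_injective hxx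
    exact (h.subset y hy _ (hPK y hy _ hx').1).2 (Finset.mem_of_mem_erase hx)
  have heQ : ∀ y ∈ X, e y ∈ Q := by
    intro y hy
    rcases heJ y hy with h1 | h1 | ⟨h1, hyJ, h2⟩
    · exact h1 ▸ hQl _
    · exact h1 ▸ hQl _
    · rw [h1]
      refine ⟨Or.inr ⟨y, ?_, rfl⟩, ?_⟩
      · simp only [hPP, Finset.coe_union]
        exact Or.inr (Finset.mem_filter.2 ⟨hyJ, h2⟩)
      · rintro z hz ⟨x, hx, hxx⟩
        obtain rfl := Sum.inr_injective hxx
        exact (hPK z hz _ hx).2 (h.eq_of_mem z hz _ (hPK z hz _ hx).1 hy)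
  have heT : ∀ y ∈ X, e y ∉ (Sum.inr '' (↑(T.erase r) : Set V) : Set (Fin 3 ⊕ V)) := by
    rintro y hy ⟨x, hx, hxe⟩
    rcases heJ y hy with h1 | h1 | ⟨h1, -, -⟩
    · rw [h1] at hxe
      cases hxe
    · rw [h1] at hxe
      cases hxe
    · rw [h1] at hxe
      obtain rfl := Sum.inr_injective hxe
      exact hXT _ hy (Finset.mem_of_mem_erase hx)
  have htree : ∀ u ∈ T, ∀ v ∈ T,
      RainbowReach G c S (Sum.inr '' (↑(T.erase r) : Set V)) u v := fun u hu v hv =>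
    ((hT.reach u hu v hv).congr hcT).mono hTS subset_rfl
  have havoid : ∀ b ∈ T, ∀ u ∈ T, ∀ v ∈ T, ¬ D b u → ¬ D b v →
      RainbowReach G c S (Sum.inr '' (↑((T.erase r).erase b) : Set V)) u v :=
    fun b hb u hu v hv h1 h2 =>
      ((hT.reach_avoid b hb u hu v hv h1 h2).congr hcT).mono hTS subset_rfl
  have ha : ∀ y ∈ X, RainbowReach G c S {Sum.inr (b y)} y (a y) := fun y hy =>
    .single (hya y hy) (hXS y hy) (hTS (haT y hy)) (by rw [hcd y hy _ (haT y hy), if_pos rfl])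
  have hb : ∀ y ∈ X, RainbowReach G c S {e y} y (b y) := fun y hy =>
    .single (hyb y hy) (hXS y hy) (hTS (hbT y hy))
      (by rw [hcd y hy _ (hbT y hy), if_neg (hne y hy), if_pos rfl])
  have hup : ∀ y ∈ X, ∀ u ∈ K y, RainbowReach G c S (B y) u y := fun y hy u hu =>
    (((hF y hy).up u hu).congr (hcK y hy)).mono (hKS y hy) subset_rfl
  have hatt : ∀ i ∈ X, ∀ j ∈ X, i ≠ j → RainbowReach G c S Q i j ∨
      ∃ t ∈ X, t ≠ i ∧ t ≠ j ∧ RainbowReach G c S (Q ∪ B t) i j := by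
    intro i hi j hj hij
    refine hT.reach_attached htree havoid haT hbT hbr hD ha hb hQT hQl heQ heT hBQ ?_ ?_
      (J := J) ?_ ?_ hi hj hij
    · intro y hy hey
      obtain ⟨hyJ, hyp⟩ := he0 y hy hey
      obtain ⟨t, ht, s, hs, hys⟩ := h.maximal y hy hyp hyJ
      have htX := h.J_subset ht
      refine ⟨t, htX, fun het => (he0 t htX het).1 ht, ?_, s, ?_, hup t htX s hs⟩
      · intro het
        rcases heJ t htX with h1 | h1 | ⟨h1, -, -⟩ <;> rw [h1] at het <;> simp at het
      · exact .single hys (hXS y hy) (hKS t htX hs)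
          (hck y hy t htX (fun hyt => hyJ (hyt ▸ ht)) s hs)
    · intro y hy hey
      rcases he1 y hy hey with h1 | h1
      · exact Or.inl h1.1
      · right
        by_contra! hcon
        refine h1 ⟨a y, b y, fun t ht hyt => ?_⟩
        by_contra! hne'
        refine hcon t ht (.single hyt (hXS y hy) (hTS ht) ?_)
        rw [hcd y hy t ht, if_neg hne'.1, if_neg hne'.2]
    · intro y hy z hz hey hez hyz
      have h1 := (he1 y (h.J_subset hy) hey).resolve_right (not_not.2 (h.J_prop y hy))
      have h2 := (he1 z (h.J_subset hz) hez).resolve_right (not_not.2 (h.J_prop z hz))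
      rw [← h1.2, ← h2.2, hyz]
    · intro y hy z hz hyz heyz
      rcases heJ y hy with h1 | h1 | ⟨h1, -, -⟩
      · exact Or.inl h1
      · exact Or.inr h1
      · rcases heJ z hz with h2 | h2 | ⟨h2, -, -⟩
        · exact Or.inl (heyz.trans h2)
        · exact Or.inr (heyz.trans h2)
        · rw [h1, h2] at heyz
          exact absurd (Sum.inr_injective heyz) hyz
  have hvia : ∀ y ∈ X, ∀ u ∈ T, ¬ D (b y) u →
      RainbowReach G c S (Sum.inr '' (↑(T.erase r) : Set V)) y u := by
    intro y hy u hu hd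
    refine (ha y hy).trans' (havoid (b y) (hbT y hy) _ (haT y hy) u hu (hD y hy) hd) ?_ ?_
      (Set.image_mono (Finset.coe_subset.2 (Finset.erase_subset _ _)))
    · rw [Set.disjoint_singleton_left]
      rintro ⟨x, hx, hxj⟩
      simp_all
    · rw [Set.singleton_subset_iff]
      exact ⟨b y, by simp [hbr y hy, hbT y hy], rfl⟩
  have hTX : ∀ y ∈ X, ∀ u ∈ T, RainbowReach G c S Q y u := by
    intro y hy u hu
    by_cases hd : D (b y) u
    · refine (hb y hy).trans' (htree _ (hbT y hy) u hu) ?_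
        (Set.singleton_subset_iff.2 (heQ y hy)) hQT
      rw [Set.disjoint_singleton_left]
      exact heT y hy
    · exact (hvia y hy u hu hd).mono subset_rfl hQT
  have hBA' : ∀ y ∈ X, B y ⊆ A := fun y hy => (hBA y hy).trans Set.subset_union_right
  have hTK : ∀ y ∈ X, ∀ v ∈ K y, ∀ u ∈ T, RainbowReach G c S A v u := fun y hy v hv u hu =>
    (hup y hy v hv).trans' (hTX y hy u hu) (hBQ y hy).symm (hBA' y hy) hQA
  refine ⟨_, PP, c, ?_, ?_, h.isAcyclic_forest hT.acyclic (F := F) (a := a) (b := b)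
    (fun y hy => (hF y hy).forest_subset) (fun y hy => (hF y hy).acyclic)
    (fun y hy => habp y (h.J_subset hy) (h.J_prop y hy)), ?_, ?_, ?_, ?_, ?_⟩
  · refine Finset.union_subset (Finset.sdiff_subset.trans hTS) (Finset.biUnion_subset.2 ?_)
    intro y hy
    have : F y ⊆ S := (hF y hy).forest_subset.trans (hKS y hy)
    split_ifs
    · exact this
    · exact (Finset.erase_subset _ _).trans this
  · refine Finset.mem_union_left _ (Finset.mem_sdiff.2 ⟨hT.root_mem, ?_⟩)
    rw [Finset.mem_image]
    rintro ⟨y, hy, hyr⟩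
    exact hbr y (h.J_subset hy) hyr
  · refine Finset.union_subset (Finset.union_subset ((Finset.erase_subset _ _).trans hTS)
      (Finset.biUnion_subset.2 fun y hy => (hF y hy).palette_subset.trans (hKS y hy))) ?_
    exact fun y hy => hXS y (h.J_subset (Finset.mem_of_mem_filter y hy))
  · rw [hPP]
    simp only [Finset.mem_union, Finset.mem_biUnion, Finset.mem_filter, Finset.mem_erase]
    rintro ((h1 | ⟨y, hy, hry⟩) | h1)
    · exact h1.1 rfl
    · exact hrK y hy (hPK y hy r hry).1
    · exact hXT r (h.J_subset h1.1) hT.root_mem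
  · exact h.card_palette hT.root_mem (fun y hy => (hF y hy).forest_subset)
      (fun y hy => (hF y hy).root_mem) (fun y hy => (hF y hy).card_lt)
      (fun y hy => hbT y (h.J_subset hy)) hg
  · intro u hu
    by_cases huT : u ∈ T
    · exact (htree u huT r hT.root_mem).mono subset_rfl hTP
    · obtain ⟨y, hy, huy⟩ := h.cover u hu huT
      refine (hup y hy u huy).trans' (hvia y hy r hT.root_mem fun hd => hbr y hy ?_)
        ((hBQ y hy).symm.mono_right hQT) (hBA y hy) hTP
      exact hT.antisymm _ (hbT y hy) _ hT.root_mem hd (hT.root_below _ (hbT y hy))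
  · intro u hu v hv
    by_cases huT : u ∈ T <;> by_cases hvT : v ∈ T
    · exact (htree u huT v hvT).mono subset_rfl (hTP.trans Set.subset_union_right)
    · obtain ⟨j, hj, hvj⟩ := h.cover v hv hvT
      exact (hTK j hj v hvj u huT).symm
    · obtain ⟨i, hi, hui⟩ := h.cover u hu huT
      exact hTK i hi u hui v hvT
    · obtain ⟨i, hi, hui⟩ := h.cover u hu huT
      obtain ⟨j, hj, hvj⟩ := h.cover v hv hvT
      rcases eq_or_ne i j with rfl | hij
      · exact (((hF i hi).reach u hui v hvj).congr (hcK i hi)).mono (hKS i hi)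
          (Set.union_subset_union_right _ (hBA i hi))
      · have hM : ∃ M, RainbowReach G c S M i j ∧ Disjoint M (B i) ∧ Disjoint M (B j) ∧
            M ⊆ A := by
          rcases hatt i hi j hj hij with h1 | ⟨t, ht, hti, htj, h1⟩
          · exact ⟨Q, h1, hBQ i hi, hBQ j hj, hQA⟩
          · exact ⟨_, h1, Set.disjoint_union_left.2 ⟨hBQ i hi, hBB t ht i hi hti⟩,
              Set.disjoint_union_left.2 ⟨hBQ j hj, hBB t ht j hj htj⟩,
              Set.union_subset hQA (hBA' t ht)⟩
        obtain ⟨M, h1, hMi, hMj, hMA⟩ := hM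
        refine ((hup i hi u hui).trans h1 hMi.symm).trans' (hup j hj v hvj).symm ?_
          (Set.union_subset (hBA' i hi) hMA) (hBA' j hj)
        exact Set.disjoint_union_left.2 ⟨hBB i hi j hj hij, hMj⟩

end Step

/-- For every finite connected simple graph `G`, there is an edge coloring with at most
`|V(G)| - fvs(G) + 2` colors under which every pair of vertices is joined by a rainbow path,
i.e. `rc(G) ≤ |V(G)| - fvs(G) + 2`. -/
theorem rc_le_card_sub_fvs_add_two {V : Type*} [Fintype V] (G : SimpleGraph V)
    (hG : G.Connected) :
    ∃ c : Sym2 V → Fin (Fintype.card V - fvsNum G + 2), IsRainbowConnected G c := by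
  classical
  obtain ⟨r⟩ := hG.nonempty
  have hle : G ≤ restr G Finset.univ := fun u v huv =>
    ⟨huv, Finset.mem_univ u, Finset.mem_univ v⟩
  obtain ⟨F, P, c, h⟩ := exists_isRainbowForest (G := G) Finset.univ (Finset.mem_univ r)
    fun u _ => (hG.preconnected u r).mono hle
  have hfvs : fvsNum G ≤ Fᶜ.card := by
    refine Nat.sInf_le ⟨Fᶜ, rfl, ?_⟩
    refine h.acyclic.comap ⟨Subtype.val, fun {x y} hxy => ?_⟩ Subtype.val_injective
    have hx := x.2
    have hy := y.2
    simp only [Finset.coe_compl, compl_compl] at hx hy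
    exact ⟨hxy, hx, hy⟩
  rw [Finset.card_compl] at hfvs
  have hFV := F.card_le_univ
  let A : Finset (Fin 3 ⊕ V) := Finset.univ.disjSum P
  have hA : (A : Set (Fin 3 ⊕ V)).encard ≤
      (Set.univ : Set (Fin (Fintype.card V - fvsNum G + 2))).encard := by
    have := h.card_lt
    rw [Set.encard_coe_eq_coe_finsetCard, Set.encard_univ, ENat.card_eq_coe_fintype_card,
      Nat.cast_le, Finset.card_disjSum, Finset.card_fin, Fintype.card_fin]
    omega
  obtain ⟨f, -, hf⟩ := A.finite_toSet.exists_injOn_of_encard_le hA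
  refine ⟨f ∘ c, fun u v => ?_⟩
  obtain ⟨p, hp, hnd, hpA⟩ := (h.reach u (Finset.mem_univ u) v (Finset.mem_univ v)).exists_path
  refine ⟨p, hp, ?_⟩
  rw [← List.map_map]
  refine hnd.map_on ?_
  have hmem : ∀ k ∈ p.edges.map c, k ∈ A := by
    intro k hk
    obtain ⟨e, he, rfl⟩ := List.mem_map.1 hk
    rcases hpA e he with ⟨n, hn⟩ | ⟨x, hx, hn⟩
    · rw [← hn]
      simp [A]
    · rw [← hn]
      simpa [A] using hx
  exact fun x hx y hy hxy => hf (hmem x hx) (hmem y hy) hxy
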